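/- Let A = (A1, A2) with A1 ∈ ℝ^{k×(N−r)}, A2 ∈ ℝ^{k×r}, r ≤ s, and 2(s−r) < k. Suppose A2 has full column rank and, with P = I − A2(A2ᵀA2)⁻¹A2ᵀ, the matrix P·A1 satisfies the RIP of order 2(s−r) with some constant δ < √2 − 1. Then for every x̄ = (x̄1, x̄2) with x̄1 ∈ ℝ^{N−r} an (s−r)-sparse vector and x̄2 ∈ ℝ^r, the problem of minimizing ‖x1‖₁ over (x1, x2) subject to A1x1 + A2x2 = A1x̄1 + A2x̄2 has a unique solution, and it is given by (x1, x2) = (x̄1, x̄2). -/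

import Mathlib

open scoped BigOperators

/-- The ℓ¹ norm of a finitely-indexed real vector. -/
noncomputable def l1norm {ι : Type*} [Fintype ι] (x : ι → ℝ) : ℝ := ∑ i, |x i|

/-- The Euclidean (ℓ²) norm of a finitely-indexed real vector. -/
noncomputable def l2norm {ι : Type*} [Fintype ι] (x : ι → ℝ) : ℝ :=
  Real.sqrt (∑ i, (x i) ^ 2)

/-- The squared Euclidean norm of a finitely-indexed real vector. -/
noncomputable def l2sq {ι : Type*} [Fintype ι] (x : ι → ℝ) : ℝ := ∑ i, (x i) ^ 2

/-- `x` is `s`-sparse: at most `s` of its components are nonzero. -/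
def IsSparse {ι : Type*} (s : ℕ) (x : ι → ℝ) : Prop :=
  ∃ S : Finset ι, S.card ≤ s ∧ ∀ i ∉ S, x i = 0

/-- The restriction `x_S` of a vector `x` to an index set `S` (zero outside `S`). -/
def restrictVec {ι : Type*} [DecidableEq ι] (S : Finset ι) (x : ι → ℝ) : ι → ℝ :=
  fun i => if i ∈ S then x i else 0

/-- `A` satisfies the Null Space Property of order `s`. -/
def NSP {κ ι : Type*} [Fintype κ] [Fintype ι] [DecidableEq ι]
    (A : Matrix κ ι ℝ) (s : ℕ) : Prop :=
  ∀ v : ι → ℝ, A.mulVec v = 0 → v ≠ 0 →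
    ∀ S : Finset ι, S.card = s → l1norm (restrictVec S v) < (1 / 2) * l1norm v

/-- `A` satisfies the Restricted Isometry Property of order `s` with constant `δ`. -/
def RIPwith {κ ι : Type*} [Fintype κ] [Fintype ι] (A : Matrix κ ι ℝ) (s : ℕ) (δ : ℝ) : Prop :=
  ∀ x : ι → ℝ, IsSparse s x →
    (1 - δ) * l2sq x ≤ l2sq (A.mulVec x) ∧ l2sq (A.mulVec x) ≤ (1 + δ) * l2sq x

/-- `A = (A1, A2)` satisfies the Null Space Property of order `t` for partially
sparse recovery (the part with matrix `A1` is the sparse part). -/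
def PartialNSP {k m r : ℕ} (A1 : Matrix (Fin k) (Fin m) ℝ) (A2 : Matrix (Fin k) (Fin r) ℝ)
    (t : ℕ) : Prop :=
  (∀ x2 : Fin r → ℝ, A2.mulVec x2 = 0 → x2 = 0) ∧
  ∀ v1 : Fin m → ℝ, v1 ≠ 0 → (∃ v2 : Fin r → ℝ, A1.mulVec v1 = A2.mulVec v2) →
    ∀ S : Finset (Fin m), S.card = t →
      l1norm (restrictVec S v1) < (1 / 2) * l1norm v1

/-- `P = I - A2 (A2ᵀ A2)⁻¹ A2ᵀ`, the orthogonal projection onto the orthogonal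
complement of the column space of `A2` (when `A2` has full column rank). -/
noncomputable def projPerp {k r : ℕ} (A2 : Matrix (Fin k) (Fin r) ℝ) :
    Matrix (Fin k) (Fin k) ℝ :=
  1 - A2 * (A2.transpose * A2)⁻¹ * A2.transpose

/-- `σ_s(x)₁`, the best `s`-term approximation error of `x` in the ℓ¹ norm. -/
noncomputable def sigma1 {ι : Type*} [Fintype ι] (s : ℕ) (x : ι → ℝ) : ℝ :=
  sInf {t | ∃ z : ι → ℝ, IsSparse s z ∧ t = l1norm (z - x)}

/-- The operator norm of a matrix induced by the Euclidean vector norms. -/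
noncomputable def opNorm2 {a b : ℕ} (M : Matrix (Fin a) (Fin b) ℝ) : ℝ :=
  sSup {t | ∃ x : Fin b → ℝ, l2norm x ≤ 1 ∧ t = l2norm (M.mulVec x)}

section PartialRecovery

open Matrix

variable {κ ι : Type*} [Fintype κ] [Fintype ι]

theorem l2sq_eq_dotProduct (x : ι → ℝ) : l2sq x = x ⬝ᵥ x := by
  simp [l2sq, dotProduct, sq]

theorem l2sq_nonneg (x : ι → ℝ) : 0 ≤ l2sq x :=
  Finset.sum_nonneg fun i _ => sq_nonneg (x i)

theorem l2sq_eq_zero {x : ι → ℝ} (hx : l2sq x = 0) : x = 0 := by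
  rw [l2sq_eq_dotProduct] at hx
  exact dotProduct_self_eq_zero.mp hx

theorem RIPwith.mono {A : Matrix κ ι ℝ} {s : ℕ} {δ ε : ℝ} (h : RIPwith A s δ) (hδε : δ ≤ ε) :
    RIPwith A s ε := by
  intro x hx
  obtain ⟨h1, h2⟩ := h x hx
  have := mul_le_mul_of_nonneg_right hδε (l2sq_nonneg x)
  constructor <;> nlinarith

/-- A matrix with the RIP almost preserves orthogonality of disjointly supported sparse vectors. -/
theorem RIPwith.dotProduct_mulVec_le {A : Matrix κ ι ℝ} {s : ℕ} {δ : ℝ} (h : RIPwith A s δ)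
    {u v : ι → ℝ} {S T : Finset ι} (hST : Disjoint S T) (hcard : S.card + T.card ≤ s)
    (hu : ∀ i ∉ S, u i = 0) (hv : ∀ i ∉ T, v i = 0) :
    A *ᵥ u ⬝ᵥ A *ᵥ v ≤ δ * (√(l2sq u) * √(l2sq v)) := by
  classical
  rcases (l2sq_nonneg u).eq_or_lt with hu0 | hu0
  · simp [l2sq_eq_zero hu0.symm, l2sq]
  rcases (l2sq_nonneg v).eq_or_lt with hv0 | hv0
  · simp [l2sq_eq_zero hv0.symm, l2sq]
  have huv : u ⬝ᵥ v = 0 := by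
    refine Finset.sum_eq_zero fun i _ => ?_
    by_cases hi : i ∈ S
    · rw [hv i (Finset.disjoint_left.mp hST hi), mul_zero]
    · rw [hu i hi, zero_mul]
  have hsparse (a b : ℝ) : IsSparse s (a • u + b • v) := by
    refine ⟨S ∪ T, (Finset.card_union_le S T).trans hcard, fun i hi => ?_⟩
    rw [Finset.mem_union, not_or] at hi
    simp [hu i hi.1, hv i hi.2]
  have hnorm (a b : ℝ) : l2sq (a • u + b • v) = a ^ 2 * l2sq u + b ^ 2 * l2sq v := by
    simp only [l2sq_eq_dotProduct, add_dotProduct, dotProduct_add, smul_dotProduct,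
      dotProduct_smul, smul_eq_mul, dotProduct_comm v u, huv]
    ring
  have himage (a b : ℝ) : l2sq (A *ᵥ (a • u + b • v)) =
      a ^ 2 * l2sq (A *ᵥ u) + b ^ 2 * l2sq (A *ᵥ v) + 2 * (a * b) * (A *ᵥ u ⬝ᵥ A *ᵥ v) := by
    simp only [l2sq_eq_dotProduct, mulVec_add, mulVec_smul, add_dotProduct, dotProduct_add,
      smul_dotProduct, dotProduct_smul, smul_eq_mul, dotProduct_comm (A *ᵥ v) (A *ᵥ u)]
    ring
  have h1 := (h _ (hsparse √(l2sq v) √(l2sq u))).2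
  have h2 := (h _ (hsparse √(l2sq v) (-√(l2sq u)))).1
  rw [hnorm, himage] at h1 h2
  have hu1 := Real.sqrt_pos.mpr hu0
  have hv1 := Real.sqrt_pos.mpr hv0
  have hu2 := Real.sq_sqrt hu0.le
  have hv2 := Real.sq_sqrt hv0.le
  have hpos := mul_pos hu1 hv1
  set a := √(l2sq u)
  set b := √(l2sq v)
  rw [← hu2, ← hv2] at h1 h2
  refine le_of_mul_le_mul_left ?_ hpos
  nlinarith

theorem RIPwith.abs_dotProduct_mulVec_le {A : Matrix κ ι ℝ} {s : ℕ} {δ : ℝ} (h : RIPwith A s δ)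
    {u v : ι → ℝ} {S T : Finset ι} (hST : Disjoint S T) (hcard : S.card + T.card ≤ s)
    (hu : ∀ i ∉ S, u i = 0) (hv : ∀ i ∉ T, v i = 0) :
    |A *ᵥ u ⬝ᵥ A *ᵥ v| ≤ δ * (√(l2sq u) * √(l2sq v)) := by
  refine abs_le'.mpr ⟨h.dotProduct_mulVec_le hST hcard hu hv, ?_⟩
  have hneg := h.dotProduct_mulVec_le (u := u) (v := -v) hST hcard hu
    fun i hi => by simp [hv i hi]
  have hl2 : l2sq (-v) = l2sq v := by simp [l2sq]
  rwa [mulVec_neg, dotProduct_neg, hl2] at hneg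

theorem exists_subset_card_eq_forall_le {α : Type*} [DecidableEq α] (f : α → ℝ) (R : Finset α)
    (t : ℕ) (ht : t ≤ R.card) :
    ∃ S ⊆ R, S.card = t ∧ ∀ i ∈ S, ∀ j ∈ R \ S, f j ≤ f i := by
  induction t with
  | zero => exact ⟨∅, by simp, by simp, by simp⟩
  | succ t ih =>
    obtain ⟨S, hSR, hS, hle⟩ := ih (by omega)
    have hne : (R \ S).Nonempty := by
      rw [← Finset.card_pos, Finset.card_sdiff_of_subset hSR]
      omega
    obtain ⟨m, hm, hmax⟩ := Finset.exists_max_image (R \ S) f hne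
    obtain ⟨hmR, hmS⟩ := Finset.mem_sdiff.mp hm
    refine ⟨insert m S, Finset.insert_subset hmR hSR, by simp [hmS, hS], fun i hi j hj => ?_⟩
    have hj' : j ∈ R \ S := by
      simp only [Finset.mem_sdiff, Finset.mem_insert, not_or] at hj ⊢
      exact ⟨hj.1, hj.2.2⟩
    rcases Finset.mem_insert.mp hi with rfl | hi
    · exact hmax j hj'
    · exact hle i hi j hj'

/-- A set `S` of `t` largest entries of `h` on `R`, together with a threshold `M` separating the
entries on `S` from the remaining ones. -/
theorem exists_subset_card_eq_threshold {α : Type*} [DecidableEq α] (h : α → ℝ) (R : Finset α)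
    {t : ℕ} (ht : 0 < t) (htR : t ≤ R.card) :
    ∃ S ⊆ R, S.card = t ∧ ∃ M, 0 ≤ M ∧ t * M ≤ ∑ i ∈ S, |h i| ∧ ∀ j ∈ R \ S, |h j| ≤ M := by
  obtain ⟨S, hSR, hS, hle⟩ := exists_subset_card_eq_forall_le (fun i => |h i|) R t htR
  obtain ⟨m, hm, hmin⟩ := Finset.exists_min_image S (fun i => |h i|)
    (Finset.card_pos.mp (hS ▸ ht))
  refine ⟨S, hSR, hS, |h m|, abs_nonneg _, ?_, hle m hm⟩
  have := Finset.card_nsmul_le_sum S (fun i => |h i|) |h m| hmin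
  rwa [hS, nsmul_eq_mul] at this

theorem sqrt_sum_sq_le_sqrt_mul {α : Type*} (h : α → ℝ) {S : Finset α} {t : ℕ} {M : ℝ}
    (hS : S.card ≤ t) (hM : 0 ≤ M) (hle : ∀ i ∈ S, |h i| ≤ M) :
    √(∑ i ∈ S, h i ^ 2) ≤ √t * M := by
  rw [← Real.sqrt_sq hM, ← Real.sqrt_mul (by positivity)]
  refine Real.sqrt_le_sqrt ?_
  calc ∑ i ∈ S, h i ^ 2 ≤ S.card • M ^ 2 :=
        Finset.sum_le_card_nsmul S _ _ fun i hi => sq_le_sq' (abs_le.mp (hle i hi)).1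
          (abs_le.mp (hle i hi)).2
    _ = S.card * M ^ 2 := nsmul_eq_mul _ _
    _ ≤ t * M ^ 2 := by gcongr

/-- Block decomposition estimate: a sum controlled on each block of at most `t` indices by the
Euclidean norm of `h` on that block is controlled by the `ℓ¹` norm of `h`. -/
theorem abs_sum_le_of_block_bound {α : Type*} [DecidableEq α] (h g : α → ℝ) {t : ℕ} (ht : 0 < t)
    {c : ℝ} (hc : 0 ≤ c) (R : Finset α)
    (hblock : ∀ S ⊆ R, S.card ≤ t → |∑ i ∈ S, g i| ≤ c * √(∑ i ∈ S, h i ^ 2))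
    {M : ℝ} (hM : 0 ≤ M) (hle : ∀ i ∈ R, |h i| ≤ M) :
    |∑ i ∈ R, g i| ≤ c * (√t * M + (∑ i ∈ R, |h i|) / √t) := by
  induction R using Finset.strongInduction generalizing M with
  | H R ih =>
  have htpos : (0 : ℝ) < √t := Real.sqrt_pos.mpr (by exact_mod_cast ht)
  rcases le_total R.card t with hR | hR
  · refine (hblock R subset_rfl hR).trans (mul_le_mul_of_nonneg_left ?_ hc)
    refine (sqrt_sum_sq_le_sqrt_mul h hR hM hle).trans (le_add_of_nonneg_right ?_)
    exact div_nonneg (Finset.sum_nonneg fun i _ => abs_nonneg _) htpos.le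
  · obtain ⟨S, hSR, hS, M', hM', hsum, hrest⟩ := exists_subset_card_eq_threshold h R ht hR
    have hlt : R \ S ⊂ R := Finset.sdiff_ssubset hSR (Finset.card_pos.mp (hS ▸ ht))
    have h1 := ih (R \ S) hlt (fun S' hS' => hblock S' (hS'.trans Finset.sdiff_subset)) hM' hrest
    have h2 : |∑ i ∈ S, g i| ≤ c * (√t * M) := (hblock S hSR hS.le).trans <|
      mul_le_mul_of_nonneg_left
        (sqrt_sum_sq_le_sqrt_mul h hS.le hM fun i hi => hle i (hSR hi)) hc
    have h3 : √t * M' ≤ (∑ i ∈ S, |h i|) / √t := by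
      rw [le_div_iff₀ htpos]
      calc √t * M' * √t = (√t * √t) * M' := by ring
        _ = t * M' := by rw [Real.mul_self_sqrt (by positivity)]
        _ ≤ _ := hsum
    rw [← Finset.sum_sdiff hSR, ← Finset.sum_sdiff hSR (f := fun i => |h i|), add_div]
    refine (abs_add_le _ _).trans ((add_le_add h1 h2).trans ?_)
    rw [← mul_add]
    refine mul_le_mul_of_nonneg_left ?_ hc
    linarith

theorem l2sq_restrictVec [DecidableEq ι] (S : Finset ι) (x : ι → ℝ) :
    l2sq (restrictVec S x) = ∑ i ∈ S, x i ^ 2 := by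
  simp [l2sq, restrictVec, ite_pow, Finset.sum_ite_mem]

theorem restrictVec_eq_zero {α : Type*} [DecidableEq α] {S : Finset α} (x : α → ℝ) :
    ∀ i ∉ S, restrictVec S x i = 0 := fun _ hi => if_neg hi

theorem dotProduct_mulVec_restrictVec [DecidableEq ι] (A : Matrix κ ι ℝ) (w : κ → ℝ)
    (S : Finset ι) (x : ι → ℝ) :
    w ⬝ᵥ A *ᵥ restrictVec S x = ∑ i ∈ S, (w ᵥ* A) i * x i := by
  rw [dotProduct_mulVec]
  simp [dotProduct, restrictVec, mul_ite, Finset.sum_ite_mem]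

theorem restrictVec_union {α : Type*} [DecidableEq α] {S T : Finset α} (hST : Disjoint S T)
    (x : α → ℝ) :
    restrictVec (S ∪ T) x = restrictVec S x + restrictVec T x := by
  ext i
  have hi : i ∈ S → i ∉ T := fun hS => Finset.disjoint_left.mp hST hS
  by_cases h1 : i ∈ S <;> by_cases h2 : i ∈ T <;> simp_all [restrictVec]

theorem sum_abs_le_sqrt_mul_sqrt {α : Type*} (h : α → ℝ) {S : Finset α} {t : ℕ}
    (hS : S.card ≤ t) : ∑ i ∈ S, |h i| ≤ √t * √(∑ i ∈ S, h i ^ 2) := by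
  rw [← Real.sqrt_mul (by positivity)]
  refine Real.le_sqrt_of_sq_le ?_
  calc (∑ i ∈ S, |h i|) ^ 2 ≤ S.card * ∑ i ∈ S, |h i| ^ 2 := sq_sum_le_card_mul_sum_sq
    _ ≤ t * ∑ i ∈ S, h i ^ 2 := by
      simp only [sq_abs]
      gcongr

/-- For a kernel vector `h`, the energy on `T` and on the `t` largest further entries `T₁` is
controlled by the `ℓ¹` norm of `h` off `T`. -/
theorem RIPwith.l2sq_restrictVec_union_le [DecidableEq ι] {A : Matrix κ ι ℝ} {t : ℕ} {δ : ℝ}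
    (hA : RIPwith A (2 * t) δ) (hδ0 : 0 ≤ δ) (ht : 0 < t) {h : ι → ℝ} (hker : A *ᵥ h = 0)
    {T T₁ : Finset ι} (hT : T.card ≤ t) (hT₁ : T₁ ⊆ Tᶜ) (hcard₁ : T₁.card = t) {M : ℝ}
    (hM : 0 ≤ M) (hsum : t * M ≤ ∑ i ∈ T₁, |h i|) (hrest : ∀ j ∈ Tᶜ \ T₁, |h j| ≤ M) :
    (1 - δ) * l2sq (restrictVec (T ∪ T₁) h) ≤
      δ * (√(l2sq (restrictVec T h)) + √(l2sq (restrictVec T₁ h))) *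
        ((∑ i ∈ Tᶜ, |h i|) / √t) := by
  have htpos : (0 : ℝ) < √t := Real.sqrt_pos.mpr (by exact_mod_cast ht)
  have hdisj : Disjoint T T₁ := Finset.disjoint_left.mpr fun i hi hi' =>
    Finset.mem_compl.mp (hT₁ hi') hi
  set R := Tᶜ \ T₁ with hR
  set Q := (∑ i ∈ Tᶜ, |h i|) / √t with hQ
  have htail {V : Finset ι} (hV : V.card ≤ t) (hVR : Disjoint V R) :
      |A *ᵥ restrictVec V h ⬝ᵥ A *ᵥ restrictVec R h| ≤ δ * √(l2sq (restrictVec V h)) * Q := by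
    rw [dotProduct_mulVec_restrictVec]
    refine (abs_sum_le_of_block_bound h _ ht (c := δ * √(l2sq (restrictVec V h)))
      (by positivity) R (fun S hSR hS => ?_) hM hrest).trans ?_
    · rw [← dotProduct_mulVec_restrictVec, ← l2sq_restrictVec, mul_assoc]
      exact hA.abs_dotProduct_mulVec_le (Finset.disjoint_of_subset_right hSR hVR) (by omega)
        (restrictVec_eq_zero h) (restrictVec_eq_zero h)
    · refine mul_le_mul_of_nonneg_left ?_ (by positivity)
      rw [hQ, ← Finset.sum_sdiff hT₁, add_div, add_comm]
      gcongr
      rw [le_div_iff₀ htpos]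
      calc √t * M * √t = (√t * √t) * M := by ring
        _ = t * M := by rw [Real.mul_self_sqrt (by positivity)]
        _ ≤ _ := hsum
  have hb₀ := htail hT (Finset.disjoint_left.mpr fun i hi hi' =>
    Finset.mem_compl.mp (Finset.mem_sdiff.mp hi').1 hi)
  have hb₁ := htail hcard₁.le Finset.disjoint_sdiff
  have hsplit : h = restrictVec T h + restrictVec T₁ h + restrictVec R h := by
    ext i
    have hi : i ∈ T → i ∉ T₁ := fun hT => Finset.disjoint_left.mp hdisj hT
    by_cases h1 : i ∈ T <;> by_cases h2 : i ∈ T₁ <;> simp_all [restrictVec]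
  have hhead : l2sq (A *ᵥ restrictVec (T ∪ T₁) h) =
      -(A *ᵥ restrictVec T h ⬝ᵥ A *ᵥ restrictVec R h
        + A *ᵥ restrictVec T₁ h ⬝ᵥ A *ᵥ restrictVec R h) := by
    have hneg : A *ᵥ restrictVec (T ∪ T₁) h = -(A *ᵥ restrictVec R h) := by
      rw [eq_neg_iff_add_eq_zero, ← mulVec_add, restrictVec_union hdisj, ← hsplit, hker]
    rw [l2sq_eq_dotProduct]
    nth_rewrite 2 [hneg]
    rw [restrictVec_union hdisj, mulVec_add, dotProduct_neg, add_dotProduct]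
  have hrip := (hA (restrictVec (T ∪ T₁) h) ⟨T ∪ T₁, by
    have := Finset.card_union_le T T₁
    omega, restrictVec_eq_zero h⟩).1
  rw [hhead] at hrip
  have h1 := (abs_le.mp hb₀).1
  have h2 := (abs_le.mp hb₁).1
  linarith

theorem eq_zero_of_sq_eq_add_sq_of_le {δ a b n Q : ℝ} (hδ0 : 0 ≤ δ) (hδ : δ < √2 - 1) (hn0 : 0 ≤ n)
    (hQ0 : 0 ≤ Q) (hn2 : n ^ 2 = a ^ 2 + b ^ 2) (hle : (1 - δ) * n ^ 2 ≤ δ * (a + b) * Q)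
    (hQn : Q ≤ n) : n = 0 := by
  have hs2 : √2 * √2 = 2 := Real.mul_self_sqrt (by norm_num)
  have hs2_pos : (0 : ℝ) ≤ √2 := Real.sqrt_nonneg 2
  have hδ1 : 0 < 1 - δ - √2 * δ := by nlinarith
  have hab : a + b ≤ √2 * n := by
    refine (abs_le_of_sq_le_sq' ?_ (by positivity)).2
    rw [mul_pow, Real.sq_sqrt (by norm_num), hn2]
    linarith [sq_nonneg (a - b)]
  have h1 : δ * (a + b) * Q ≤ δ * (√2 * n) * n := by gcongr
  have h2 : (1 - δ - √2 * δ) * n ^ 2 ≤ 0 := by linarith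
  have h3 : n ^ 2 ≤ 0 := nonpos_of_mul_nonpos_right h2 hδ1
  exact pow_eq_zero_iff two_ne_zero |>.mp (le_antisymm h3 (sq_nonneg n))

/-- The RIP of order `2 t` with constant below `√2 - 1` forces the mass of a nonzero kernel vector
on any `t` indices to be less than its mass on the other ones. -/
theorem RIPwith.sum_abs_lt_of_mulVec_eq_zero [DecidableEq ι] {A : Matrix κ ι ℝ} {t : ℕ} {δ : ℝ}
    (hA : RIPwith A (2 * t) δ) (hδ0 : 0 ≤ δ) (hδ : δ < √2 - 1) {h : ι → ℝ}
    (hker : A *ᵥ h = 0) (hne : h ≠ 0) {T : Finset ι} (hT : T.card ≤ t) :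
    ∑ i ∈ T, |h i| < ∑ i ∈ Tᶜ, |h i| := by
  have hs2 : √2 * √2 = 2 := Real.mul_self_sqrt (by norm_num)
  have hs2_pos : (0 : ℝ) ≤ √2 := Real.sqrt_nonneg 2
  have hδ1 : 0 < 1 - δ - √2 * δ := by nlinarith
  rcases Nat.eq_zero_or_pos t with rfl | ht
  · obtain rfl : T = ∅ := Finset.card_eq_zero.mp (Nat.le_zero.mp hT)
    obtain ⟨i, hi⟩ := Function.ne_iff.mp hne
    simpa using Finset.sum_pos' (fun j _ => abs_nonneg (h j)) ⟨i, Finset.mem_univ i, abs_pos.mpr hi⟩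
  rcases le_total (Tᶜ).card t with hTc | hTc
  · have hsparse : IsSparse (2 * t) h := by
      refine ⟨Finset.univ, ?_, by simp⟩
      rw [Finset.card_univ, ← Finset.card_add_card_compl T]
      omega
    have h1 := (hA h hsparse).1
    have h2 : l2sq (A *ᵥ h) = 0 := by simp [hker, l2sq]
    exact absurd (l2sq_eq_zero (by nlinarith [l2sq_nonneg h, mul_nonneg hs2_pos hδ0])) hne
  obtain ⟨T₁, hT₁, hcard₁, M, hM, hsum, hrest⟩ := exists_subset_card_eq_threshold h Tᶜ ht hTc
  have htpos : (0 : ℝ) < √t := Real.sqrt_pos.mpr (by exact_mod_cast ht)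
  have hdisj : Disjoint T T₁ := Finset.disjoint_left.mpr fun i hi hi' =>
    Finset.mem_compl.mp (hT₁ hi') hi
  have hcone := hA.l2sq_restrictVec_union_le hδ0 ht hker hT hT₁ hcard₁ hM hsum hrest
  have hn2 : √(l2sq (restrictVec (T ∪ T₁) h)) ^ 2 =
      √(l2sq (restrictVec T h)) ^ 2 + √(l2sq (restrictVec T₁ h)) ^ 2 := by
    rw [Real.sq_sqrt (l2sq_nonneg _), Real.sq_sqrt (l2sq_nonneg _), Real.sq_sqrt (l2sq_nonneg _)]
    simp only [l2sq_restrictVec, Finset.sum_union hdisj]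
  rw [← Real.sq_sqrt (l2sq_nonneg (restrictVec (T ∪ T₁) h))] at hcone
  have hn0 := Real.sqrt_nonneg (l2sq (restrictVec (T ∪ T₁) h))
  have hT_sum := sum_abs_le_sqrt_mul_sqrt h hT
  rw [← l2sq_restrictVec] at hT_sum
  generalize √(l2sq (restrictVec T h)) = a at *
  generalize √(l2sq (restrictVec T₁ h)) = b at *
  generalize √(l2sq (restrictVec (T ∪ T₁) h)) = n at *
  have hTc_nonneg : 0 ≤ ∑ i ∈ Tᶜ, |h i| := Finset.sum_nonneg fun i _ => abs_nonneg _
  have han : a ≤ n := (abs_le_of_sq_le_sq' (by linarith [sq_nonneg b]) hn0).2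
  have hlt : n < (∑ i ∈ Tᶜ, |h i|) / √t := by
    by_contra! hle
    have hn : n = 0 := eq_zero_of_sq_eq_add_sq_of_le hδ0 hδ hn0
      (div_nonneg hTc_nonneg htpos.le) hn2 hcone hle
    subst hn
    have hTc0 : ∑ i ∈ Tᶜ, |h i| = 0 :=
      le_antisymm (by simpa using (div_le_iff₀ htpos).mp hle) hTc_nonneg
    have hT0 : ∑ i ∈ T, |h i| = 0 :=
      le_antisymm (hT_sum.trans (mul_nonpos_of_nonneg_of_nonpos htpos.le han))
        (Finset.sum_nonneg fun i _ => abs_nonneg _)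
    rw [Finset.sum_eq_zero_iff_of_nonneg fun i _ => abs_nonneg _] at hTc0 hT0
    refine hne (funext fun i => ?_)
    by_cases hi : i ∈ T
    · exact abs_eq_zero.mp (hT0 i hi)
    · exact abs_eq_zero.mp (hTc0 i (Finset.mem_compl.mpr hi))
  calc ∑ i ∈ T, |h i| ≤ √t * n := hT_sum.trans (by gcongr)
    _ < √t * ((∑ i ∈ Tᶜ, |h i|) / √t) := by gcongr
    _ = ∑ i ∈ Tᶜ, |h i| := mul_div_cancel₀ _ htpos.ne'

theorem l1norm_lt_of_sum_abs_sub_lt [DecidableEq ι] {x y : ι → ℝ} {T : Finset ι}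
    (hx : ∀ i ∉ T, x i = 0) (h : ∑ i ∈ T, |y i - x i| < ∑ i ∈ Tᶜ, |y i - x i|) :
    l1norm x < l1norm y := by
  have hTc : ∑ i ∈ Tᶜ, |y i - x i| = ∑ i ∈ Tᶜ, |y i| :=
    Finset.sum_congr rfl fun i hi => by rw [hx i (Finset.mem_compl.mp hi), sub_zero]
  have hTc0 : ∑ i ∈ Tᶜ, |x i| = 0 :=
    Finset.sum_eq_zero fun i hi => by rw [hx i (Finset.mem_compl.mp hi), abs_zero]
  have hT : ∑ i ∈ T, |x i| ≤ ∑ i ∈ T, |y i| + ∑ i ∈ T, |y i - x i| := by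
    rw [← Finset.sum_add_distrib]
    refine Finset.sum_le_sum fun i _ => ?_
    have := abs_sub_abs_le_abs_sub (x i) (y i)
    rw [abs_sub_comm] at this
    linarith
  rw [l1norm, l1norm, ← Finset.sum_add_sum_compl T, ← Finset.sum_add_sum_compl T]
  linarith

theorem projPerp_mul_self {k r : ℕ} (A : Matrix (Fin k) (Fin r) ℝ)
    (hA : ∀ x : Fin r → ℝ, A *ᵥ x = 0 → x = 0) : projPerp A * A = 0 := by
  have hunit : IsUnit (Aᵀ * A) := by
    rw [← mulVec_injective_iff_isUnit, ← coe_mulVecLin, injective_iff_map_eq_zero]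
    intro x hx
    refine hA x (dotProduct_self_eq_zero.mp ?_)
    rw [mulVecLin_apply, ← mulVec_mulVec] at hx
    rw [dotProduct_mulVec, ← mulVec_transpose, hx, zero_dotProduct]
  rw [projPerp, Matrix.sub_mul, Matrix.one_mul, Matrix.mul_assoc, Matrix.mul_assoc,
    nonsing_inv_mul _ ((isUnit_iff_isUnit_det _).mp hunit), Matrix.mul_one, sub_self]

end PartialRecovery

/-- If `A2` has full column rank and `P·A1` satisfies the RIP of order
`2(s-r)` with some constant `δ < √2 - 1` (with `r ≤ s` and `2(s-r) < k`), then every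
`x̄ = (x̄1, x̄2)` with `x̄1` an `(s-r)`-sparse vector is the unique solution of
`min ‖x1‖₁ s.t. A1 x1 + A2 x2 = A1 x̄1 + A2 x̄2`. -/
theorem partial_rip_implies_unique_partial_recovery {k N r s : ℕ} (hr : r ≤ s)
    (hks : 2 * (s - r) < k)
    (A1 : Matrix (Fin k) (Fin (N - r)) ℝ) (A2 : Matrix (Fin k) (Fin r) ℝ)
    (hA2 : ∀ x2 : Fin r → ℝ, A2.mulVec x2 = 0 → x2 = 0)
    (δ : ℝ) (hδ : δ < Real.sqrt 2 - 1)
    (hRIP : RIPwith (projPerp A2 * A1) (2 * (s - r)) δ) :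
    ∀ (x1bar : Fin (N - r) → ℝ) (x2bar : Fin r → ℝ), IsSparse (s - r) x1bar →
      ∀ (x1 : Fin (N - r) → ℝ) (x2 : Fin r → ℝ),
        A1.mulVec x1 + A2.mulVec x2 = A1.mulVec x1bar + A2.mulVec x2bar →
        (x1, x2) ≠ (x1bar, x2bar) →
        l1norm x1bar < l1norm x1 := by
  rintro x1bar x2bar ⟨T, hT, hsupp⟩ x1 x2 heq hne
  refine l1norm_lt_of_sum_abs_sub_lt hsupp ?_
  have hsub : A1.mulVec (x1 - x1bar) = A2.mulVec (x2bar - x2) := by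
    rw [Matrix.mulVec_sub, Matrix.mulVec_sub, sub_eq_sub_iff_add_eq_add, heq, add_comm]
  have hker : (projPerp A2 * A1).mulVec (x1 - x1bar) = 0 := by
    rw [← Matrix.mulVec_mulVec, hsub, Matrix.mulVec_mulVec, projPerp_mul_self A2 hA2,
      Matrix.zero_mulVec]
  have hne1 : x1 - x1bar ≠ 0 := by
    intro h0
    rw [h0, Matrix.mulVec_zero] at hsub
    exact hne (Prod.ext (sub_eq_zero.mp h0) (sub_eq_zero.mp (hA2 _ hsub.symm)).symm)
  have hsqrt : (0 : ℝ) < Real.sqrt 2 - 1 := sub_pos.mpr Real.one_lt_sqrt_two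
  exact (hRIP.mono (le_max_left δ 0)).sum_abs_lt_of_mulVec_eq_zero (le_max_right δ 0)
    (max_lt hδ hsqrt) hker hne1 hT
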